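/- Let p be a positive integer, Σ and Q be p × p real symmetric positive definite matrices, c > 0 and z ≥ 0. Let s₀ > 0 be the unique positive solution of s = (c/p)·tr[Σ·(Σ/(1+s) + Q + z·Σ)^{-1}], and set S = Σ/(1+s₀) + Q + z·Σ. Then there exists a unique real number s₁ satisfying s₁ = (c/p)·tr[Σ·S^{-1}·((s₁/(1+s₀)²)·Σ − Q)·S^{-1}], and it satisfies −s₀ ≤ s₁ < 0. -/

import Mathlib

open Matrix Filter

open scoped MatrixOrder in
/-- The trace of a product of two positive definite real matrices is positive. -/
theorem Matrix.PosDef.trace_mul_pos {n : Type*} [Fintype n] [DecidableEq n] [Nonempty n]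
    {A B : Matrix n n ℝ} (hA : A.PosDef) (hB : B.PosDef) : 0 < (A * B).trace := by
  obtain ⟨C, rfl⟩ := CStarAlgebra.nonneg_iff_eq_star_mul_self.mp hA.posSemidef.nonneg
  have hC : IsUnit C := isUnit_of_mul_isUnit_right hA.isUnit
  rw [mul_assoc, trace_mul_comm]
  exact ((Matrix.IsUnit.posDef_star_right_conjugate_iff hC).mpr hB).trace_pos

/-- Congruence of a positive definite matrix by a positive definite matrix. -/
theorem Matrix.PosDef.conj_posDef {n : Type*} [Fintype n] [DecidableEq n]
    {A T : Matrix n n ℝ} (hA : A.PosDef) (hT : T.PosDef) : (T * A * T).PosDef := by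
  have h := (Matrix.IsUnit.posDef_star_right_conjugate_iff hT.isUnit).mpr hA
  rwa [star_eq_conjTranspose, hT.isHermitian.eq] at h

theorem stmt9 (p : ℕ) (hp : 0 < p)
    (Sig Q : Matrix (Fin p) (Fin p) ℝ)
    (hSig : Sig.PosDef) (hQ : Q.PosDef)
    (c z : ℝ) (hc : 0 < c) (hz : 0 ≤ z)
    (s₀ : ℝ) (hs₀pos : 0 < s₀)
    (hs₀eq : s₀ = c / (p : ℝ) *
      (Sig * ((1 + s₀)⁻¹ • Sig + Q + z • Sig)⁻¹).trace) :
    (∃! s₁ : ℝ, s₁ = c / (p : ℝ) *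
      (Sig * ((1 + s₀)⁻¹ • Sig + Q + z • Sig)⁻¹ *
        ((s₁ / (1 + s₀) ^ 2) • Sig - Q) *
        ((1 + s₀)⁻¹ • Sig + Q + z • Sig)⁻¹).trace) ∧
    ∀ s₁ : ℝ, s₁ = c / (p : ℝ) *
      (Sig * ((1 + s₀)⁻¹ • Sig + Q + z • Sig)⁻¹ *
        ((s₁ / (1 + s₀) ^ 2) • Sig - Q) *
        ((1 + s₀)⁻¹ • Sig + Q + z • Sig)⁻¹).trace →
      -s₀ ≤ s₁ ∧ s₁ < 0 := by
  have : Nonempty (Fin p) := ⟨⟨0, hp⟩⟩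
  set S := (1 + s₀)⁻¹ • Sig + Q + z • Sig with hSdef
  set k := c / (p : ℝ) with hk
  have hkpos : 0 < k := div_pos hc (Nat.cast_pos.mpr hp)
  have hS : S.PosDef :=
    ((hSig.smul (by positivity)).add hQ).add_posSemidef (hSig.posSemidef.smul hz)
  have hA := hSig.trace_mul_pos (hSig.conj_posDef hS.inv)
  have hB := hSig.trace_mul_pos (hQ.conj_posDef hS.inv)
  set a := (Sig * (S⁻¹ * Sig * S⁻¹)).trace
  set b := (Sig * (S⁻¹ * Q * S⁻¹)).trace
  have hresolvent : S⁻¹ = S⁻¹ * S * S⁻¹ := by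
    rw [nonsing_inv_mul S ((isUnit_iff_isUnit_det S).mp hS.isUnit), one_mul]
  have htrace : (Sig * S⁻¹).trace = (1 + s₀)⁻¹ * a + b + z * a := by
    rw [hresolvent]
    nth_rw 2 [hSdef]
    simp only [mul_add, add_mul, trace_add, mul_smul_comm, smul_mul_assoc, trace_smul,
      smul_eq_mul, a, b]
  have hlinear (s : ℝ) :
      (Sig * S⁻¹ * ((s / (1 + s₀) ^ 2) • Sig - Q) * S⁻¹).trace = s / (1 + s₀) ^ 2 * a - b := by
    simp only [mul_sub, sub_mul, trace_sub, mul_smul_comm, smul_mul_assoc, trace_smul,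
      smul_eq_mul, a, b, mul_assoc]
  simp only [hlinear]
  rw [htrace] at hs₀eq
  have hs : 0 < 1 + s₀ := by linarith
  have hx : 0 < k * a / (1 + s₀) ^ 2 := by positivity
  set x := k * a / (1 + s₀) ^ 2
  have hkb : 0 < k * b := mul_pos hkpos hB
  have hbalance : s₀ = x * (1 + s₀) + k * b + k * (z * a) := by
    have : x * (1 + s₀) = k * ((1 + s₀)⁻¹ * a) := by simp only [x]; field_simp
    rw [this]
    linarith
  have hkza : 0 ≤ k * (z * a) := by positivity
  have hD : 0 < 1 - x := by
    by_contra! h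
    nlinarith
  have heq (s : ℝ) : s = k * (s / (1 + s₀) ^ 2 * a - b) ↔ s = -(k * b) / (1 - x) := by
    have : k * (s / (1 + s₀) ^ 2 * a - b) = s * x - k * b := by simp only [x]; ring
    rw [this, eq_div_iff hD.ne']
    constructor <;> intro h <;> linarith
  simp only [heq]
  refine ⟨⟨_, rfl, fun _ h => h⟩, ?_⟩
  rintro s rfl
  refine ⟨?_, div_neg_of_neg_of_pos (neg_neg_of_pos hkb) hD⟩
  rw [le_div_iff₀ hD]
  linarith
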